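/- Let α ∈ ℝ, α ≠ 0, and set E₁ := −exp(4π/α). If E ∈ ℝ and E > −E₁ = exp(4π/α), then for every λ ∈ ℂ\{0} one has d(k_E(λ)) := 1 − (α/(2π))·ln(|Re k_E(λ)| + |Im k_E(λ)|) ≠ 0. Hence the Faddeev generalized scattering data a(k_E(λ)) = b(k_E(λ)) = (2π)⁻²·α/d(k_E(λ)) of the two-dimensional point potential have no singularities in λ on ℂ\{0} at such energies (in particular they are continuous on (ℂ ∪ {∞})\{|λ| = 1} and in a neighborhood of the unit circle). -/

import Mathlib

/-- The principal square root of a real number, viewed in `ℂ`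
(so `√E = i√(−E)` for `E < 0`). -/
noncomputable def sqrtC (E : ℝ) : ℂ := (E : ℂ) ^ (1/2 : ℂ)

/-- The rational parametrization `k_E(λ) = ((λ + λ⁻¹)√E/2, i(λ⁻¹ − λ)√E/2) ∈ ℂ²`
of the fixed-energy surface `{k ∈ ℂ² : k² = E}`. -/
noncomputable def kE (E : ℝ) (lam : ℂ) : ℂ × ℂ :=
  ((lam + lam⁻¹) * sqrtC E / 2, Complex.I * (lam⁻¹ - lam) * sqrtC E / 2)

/-- Euclidean norm `|Re k|` of the componentwise real part of `k ∈ ℂ²`. -/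
noncomputable def normRe (k : ℂ × ℂ) : ℝ := Real.sqrt (k.1.re ^ 2 + k.2.re ^ 2)

/-- Euclidean norm `|Im k|` of the componentwise imaginary part of `k ∈ ℂ²`. -/
noncomputable def normIm (k : ℂ × ℂ) : ℝ := Real.sqrt (k.1.im ^ 2 + k.2.im ^ 2)

/-- The denominator `d(k) = 1 − (α/2π)·ln(|Re k| + |Im k|)` of the Faddeev generalized
scattering data `a(k) = b(k) = (2π)⁻²·α/d(k)` of the 2D point potential of strength `α`. -/
noncomputable def dFad (α : ℝ) (k : ℂ × ℂ) : ℝ :=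
  1 - α / (2 * Real.pi) * Real.log (normRe k + normIm k)

theorem kE_sq (E : ℝ) (lam : ℂ) (h : lam ≠ 0) :
    (kE E lam).1 ^ 2 + (kE E lam).2 ^ 2 = (E : ℂ) := by
  have hs : sqrtC E ^ 2 = (E : ℂ) := by
    unfold sqrtC
    rw [← Complex.cpow_nat_mul]
    norm_num
  have hl : lam * lam⁻¹ = 1 := mul_inv_cancel₀ h
  simp only [kE]
  linear_combination (lam * lam⁻¹) * hs + (E : ℂ) * hl +
    (lam⁻¹ - lam) ^ 2 * sqrtC E ^ 2 / 4 * Complex.I_sq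

theorem sqrt_le_normRe (E : ℝ) (lam : ℂ) (h : lam ≠ 0) :
    Real.sqrt E ≤ normRe (kE E lam) := by
  have h1 := congrArg Complex.re (kE_sq E lam h)
  simp only [pow_two, Complex.add_re, Complex.mul_re, Complex.ofReal_re] at h1
  unfold normRe
  apply Real.sqrt_le_sqrt
  nlinarith [sq_nonneg (kE E lam).1.im, sq_nonneg (kE E lam).2.im]

theorem exp_lt_norm (α E : ℝ) (hE : Real.exp (4 * Real.pi / α) < E) (lam : ℂ) (h : lam ≠ 0) :
    Real.exp (2 * Real.pi / α) < normRe (kE E lam) + normIm (kE E lam) := by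
  have h1 := sqrt_le_normRe E lam h
  have h2 : 0 ≤ normIm (kE E lam) := Real.sqrt_nonneg _
  have h3 : Real.exp (2 * Real.pi / α) < Real.sqrt E := by
    apply Real.lt_sqrt_of_sq_lt
    rw [← Real.exp_nat_mul]
    convert hE using 2
    push_cast
    ring
  linarith

theorem dFad_kE_ne (α : ℝ) (hα : α ≠ 0) (E : ℝ) (hE : Real.exp (4 * Real.pi / α) < E)
    (lam : ℂ) (h : lam ≠ 0) : dFad α (kE E lam) ≠ 0 := by
  intro hd
  have h1 := exp_lt_norm α E hE lam h
  have h2 := (Real.lt_log_iff_exp_lt ((Real.exp_pos _).trans h1)).2 h1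
  unfold dFad at hd
  apply h2.ne
  have hp := Real.pi_ne_zero
  field_simp at hd ⊢
  linarith

/-- Let `α ≠ 0`, `E₁ := −exp(4π/α)`, and `E > −E₁ = exp(4π/α)`. Then
`d(k_E(λ)) ≠ 0` for every `λ ∈ ℂ\{0}`; hence the Faddeev generalized scattering data
`a(k_E(λ)) = b(k_E(λ)) = (2π)⁻²·α/d(k_E(λ))` have no singularities in `λ` on `ℂ\{0}`
at such energies. -/
theorem point_potential_data_regular_large_energy
    (α : ℝ) (hα : α ≠ 0) (E : ℝ) (hE : Real.exp (4 * Real.pi / α) < E) :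
    (∀ lam : ℂ, lam ≠ 0 → dFad α (kE E lam) ≠ 0) ∧
    ContinuousOn (fun lam : ℂ => ((2 * Real.pi) ^ 2)⁻¹ * α / dFad α (kE E lam))
      {lam : ℂ | lam ≠ 0} := by
  refine ⟨dFad_kE_ne α hα E hE, ?_⟩
  have hinv : ContinuousOn (fun lam : ℂ => lam⁻¹) {lam : ℂ | lam ≠ 0} :=
    continuousOn_id.inv₀ (fun x hx => hx)
  have hk : ContinuousOn (fun lam : ℂ => kE E lam) {lam : ℂ | lam ≠ 0} := by
    unfold kE
    fun_prop
  have hn : Continuous (fun k : ℂ × ℂ => normRe k + normIm k) := by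
    unfold normRe normIm
    fun_prop
  refine continuousOn_const.div ?_ (fun lam h => dFad_kE_ne α hα E hE lam h)
  unfold dFad
  exact continuousOn_const.sub (continuousOn_const.mul ((hn.comp_continuousOn hk).log
    (fun lam h => ((Real.exp_pos _).trans (exp_lt_norm α E hE lam h)).ne')))
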